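/- arXiv:1503.01149 — 2 statements merged into one kernel-verified Lean document; each statement's English description precedes it below -/
import Mathlib

section
/- Let K be an algebraically closed field of characteristic 0, let d ≥ 4, and let F ∈ K[X,Y,Z] be a nonsingular homogeneous polynomial of degree d. If σ ∈ Aut(F) is an element of finite order m ≥ 1, then m divides at least one of the numbers d−1, d, d²−3d+3, (d−1)², d(d−2), d(d−1). In particular m ≤ d(d−1). -/
open MvPolynomial Matrix

noncomputable section

variable {K : Type*} [Field K]

/-- The substitution `F ∘ A`, i.e. `X i ↦ ∑ j, A i j • X j`. -/
def substPoly (A : Matrix (Fin 3) (Fin 3) K) (F : MvPolynomial (Fin 3) K) :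
    MvPolynomial (Fin 3) K :=
  aeval (fun i => ∑ j, A i j • X j) F

lemma substPoly_one (F : MvPolynomial (Fin 3) K) : substPoly 1 F = F := by
  have h : (fun i => ∑ j, (1 : Matrix (Fin 3) (Fin 3) K) i j • X j)
      = (X : Fin 3 → MvPolynomial (Fin 3) K) := by
    funext i
    simp [Matrix.one_apply, ite_smul]
  rw [substPoly, h]
  exact aeval_X_left_apply F

lemma substPoly_smul (A : Matrix (Fin 3) (Fin 3) K) (c : K) (F : MvPolynomial (Fin 3) K) :
    substPoly A (c • F) = c • substPoly A F := by
  unfold substPoly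
  exact _root_.map_smul (aeval fun i => ∑ j, A i j • X j) c F

lemma substPoly_mul (A B : Matrix (Fin 3) (Fin 3) K) (F : MvPolynomial (Fin 3) K) :
    substPoly (A * B) F = substPoly B (substPoly A F) := by
  have hfun : (fun i => ∑ j, (A * B) i j • (X j : MvPolynomial (Fin 3) K))
      = fun i => (aeval fun i => (∑ j, B i j • X j : MvPolynomial (Fin 3) K))
          (∑ j, A i j • X j : MvPolynomial (Fin 3) K) := by
    funext i
    rw [map_sum]
    simp only [_root_.map_smul, aeval_X, Matrix.mul_apply, Finset.sum_smul, Finset.smul_sum, smul_smul]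
    exact Finset.sum_comm
  have h1 : substPoly (A * B) F
      = aeval (fun i => (aeval fun i => (∑ j, B i j • X j : MvPolynomial (Fin 3) K))
          (∑ j, A i j • X j : MvPolynomial (Fin 3) K)) F := by
    unfold substPoly
    exact congrArg
      (fun f => (aeval f : MvPolynomial (Fin 3) K →ₐ[K] MvPolynomial (Fin 3) K) F) hfun
  rw [h1, ← MvPolynomial.comp_aeval]
  rfl

/-- The subgroup of `GL₃(K)` preserving the polynomial `F` up to scalar. -/
def autGL (F : MvPolynomial (Fin 3) K) : Subgroup (GL (Fin 3) K) where
  carrier := {A | ∃ c : Kˣ, substPoly (A : Matrix (Fin 3) (Fin 3) K) F = (c : K) • F}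
  one_mem' := ⟨1, by simp [substPoly_one]⟩
  mul_mem' := by
    rintro A B ⟨c, hc⟩ ⟨e, he⟩
    refine ⟨c * e, ?_⟩
    have hAB : ((A * B : GL (Fin 3) K) : Matrix (Fin 3) (Fin 3) K)
        = (A : Matrix (Fin 3) (Fin 3) K) * (B : Matrix (Fin 3) (Fin 3) K) := rfl
    rw [hAB, substPoly_mul, hc, substPoly_smul, he, smul_smul, ← Units.val_mul]
  inv_mem' := by
    rintro A ⟨c, hc⟩
    refine ⟨c⁻¹, ?_⟩
    have key : (c : K) • substPoly ((A⁻¹ : GL (Fin 3) K) : Matrix (Fin 3) (Fin 3) K) F = F := by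
      rw [← substPoly_smul, ← hc, ← substPoly_mul]
      have h1 : (A : Matrix (Fin 3) (Fin 3) K) *
          ((A⁻¹ : GL (Fin 3) K) : Matrix (Fin 3) (Fin 3) K) = 1 := by
        exact_mod_cast Units.mul_inv A
      rw [h1, substPoly_one]
    calc substPoly ((A⁻¹ : GL (Fin 3) K) : Matrix (Fin 3) (Fin 3) K) F
        = ((c : K)⁻¹ * (c : K)) •
            substPoly ((A⁻¹ : GL (Fin 3) K) : Matrix (Fin 3) (Fin 3) K) F := by
          rw [inv_mul_cancel₀ (Units.ne_zero c), one_smul]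
      _ = (c : K)⁻¹ • ((c : K) •
            substPoly ((A⁻¹ : GL (Fin 3) K) : Matrix (Fin 3) (Fin 3) K) F) := by
          rw [smul_smul]
      _ = (c : K)⁻¹ • F := by rw [key]
      _ = ((c⁻¹ : Kˣ) : K) • F := by rw [Units.val_inv_eq_inv_val]

/-- `PGL₃(K)`: the quotient of `GL₃(K)` by its center (the scalar matrices). -/
abbrev PGL3 (K : Type*) [Field K] := GL (Fin 3) K ⧸ Subgroup.center (GL (Fin 3) K)

/-- The automorphism group of the plane curve `F = 0`, as a subgroup of `PGL₃(K)`: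
the classes of matrices `A` with `F ∘ A = λ • F` for some `λ ∈ Kˣ`. -/
def projAut (F : MvPolynomial (Fin 3) K) : Subgroup (PGL3 K) :=
  (autGL F).map (QuotientGroup.mk' (Subgroup.center (GL (Fin 3) K)))

/-- `F` is nonsingular: the only common zero of its partial derivatives is the origin. -/
def IsNonsingular (F : MvPolynomial (Fin 3) K) : Prop :=
  ∀ x : Fin 3 → K, (∀ i, eval x (pderiv i F) = 0) → x = 0

/-- `F` and `G` are projectively equivalent: `F ∘ A = λ • G` for some `A ∈ GL₃(K)`, `λ ∈ Kˣ`. -/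
def ProjEquiv (F G : MvPolynomial (Fin 3) K) : Prop :=
  ∃ A : GL (Fin 3) K, ∃ c : Kˣ,
    substPoly (A : Matrix (Fin 3) (Fin 3) K) F = (c : K) • G

/-! ### Evaluation and differentiation of `substPoly` -/

lemma eval_substPoly (A : Matrix (Fin 3) (Fin 3) K) (F : MvPolynomial (Fin 3) K)
    (x : Fin 3 → K) : eval x (substPoly A F) = eval (A *ᵥ x) F := by
  unfold substPoly
  induction F using MvPolynomial.induction_on with
  | C a => simp [MvPolynomial.algebraMap_eq]
  | add p q hp hq => rw [map_add, map_add, map_add, hp, hq]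
  | mul_X p i hp =>
    rw [map_mul, map_mul, map_mul, hp, aeval_X]
    simp [Matrix.mulVec, dotProduct, smul_eval]

lemma eval_pderiv_substPoly (A : Matrix (Fin 3) (Fin 3) K) (F : MvPolynomial (Fin 3) K)
    (x : Fin 3 → K) (j : Fin 3) :
    eval x (pderiv j (substPoly A F)) = ∑ i, A i j * eval (A *ᵥ x) (pderiv i F) := by
  induction F using MvPolynomial.induction_on with
  | C a => simp [substPoly, MvPolynomial.algebraMap_eq]
  | add p q hp hq =>
    have : substPoly A (p + q) = substPoly A p + substPoly A q := by simp [substPoly]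
    rw [this]
    simp only [map_add, hp, hq, mul_add, Finset.sum_add_distrib]
  | mul_X p i hp =>
    have h1 : substPoly A (p * X i) = substPoly A p * ∑ j, A i j • X j := by simp [substPoly]
    have h2 : eval x (∑ j, A i j • (X j : MvPolynomial (Fin 3) K)) = (A *ᵥ x) i := by
      simp [Matrix.mulVec, dotProduct, smul_eval]
    have h3 : eval x (pderiv j (∑ j, A i j • (X j : MvPolynomial (Fin 3) K))) = A i j := by
      simp only [map_sum, Derivation.map_smul, smul_eval, pderiv_X]
      rw [Finset.sum_eq_single j]
      · simp
      · intro b _ hb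
        simp [hb.symm]
      · simp
    rw [h1]
    simp only [Derivation.leibniz, map_add, smul_eq_mul, map_mul, h2, h3, hp, eval_substPoly,
      eval_X, mul_add, Finset.sum_add_distrib, pderiv_X]
    congr 1
    · rw [Finset.sum_eq_single i]
      · simp [mul_comm]
      · intro b _ hb
        simp [hb.symm]
      · simp
    · rw [Finset.mul_sum]
      refine Finset.sum_congr rfl fun b _ => by ring

lemma isNonsingular_substPoly (A : GL (Fin 3) K) (F : MvPolynomial (Fin 3) K)
    (h : IsNonsingular F) : IsNonsingular (substPoly (A : Matrix (Fin 3) (Fin 3) K) F) := by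
  intro x hx
  have hv : (fun i => eval ((A : Matrix (Fin 3) (Fin 3) K) *ᵥ x) (pderiv i F)) = 0 := by
    set v := fun i => eval ((A : Matrix (Fin 3) (Fin 3) K) *ᵥ x) (pderiv i F) with hvdef
    have h0 : v ᵥ* (A : Matrix (Fin 3) (Fin 3) K) = 0 := by
      funext j
      have := hx j
      rw [eval_pderiv_substPoly] at this
      simp only [Matrix.vecMul, dotProduct, Pi.zero_apply]
      rw [← this]
      exact Finset.sum_congr rfl fun i _ => mul_comm _ _
    have h1 : v ᵥ* ((A : Matrix (Fin 3) (Fin 3) K) *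
        ((A⁻¹ : GL (Fin 3) K) : Matrix (Fin 3) (Fin 3) K)) = 0 := by
      rw [← Matrix.vecMul_vecMul, h0, Matrix.zero_vecMul]
    rw [← Units.val_mul, mul_inv_cancel, Units.val_one, Matrix.vecMul_one] at h1
    exact h1
  have h2 := h _ fun i => congrFun hv i
  have h3 : (((A⁻¹ : GL (Fin 3) K) : Matrix (Fin 3) (Fin 3) K) *
      (A : Matrix (Fin 3) (Fin 3) K)) *ᵥ x = 0 := by
    rw [← Matrix.mulVec_mulVec, h2, Matrix.mulVec_zero]
  rwa [← Units.val_mul, inv_mul_cancel, Units.val_one, Matrix.one_mulVec] at h3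

lemma isHomogeneous_substPoly (A : Matrix (Fin 3) (Fin 3) K) (F : MvPolynomial (Fin 3) K)
    (d : ℕ) (h : F.IsHomogeneous d) : (substPoly A F).IsHomogeneous d := by
  have := h.aeval (fun i => ∑ j, A i j • (X j : MvPolynomial (Fin 3) K)) (n := 1) (by
    intro i
    refine IsHomogeneous.sum _ _ _ fun j _ => ?_
    rw [smul_eq_C_mul]
    exact isHomogeneous_C_mul_X _ _)
  simpa [substPoly] using this

lemma coeff_substPoly_diagonal (a : Fin 3 → K) (F : MvPolynomial (Fin 3) K) (n : Fin 3 →₀ ℕ) :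
    coeff n (substPoly (Matrix.diagonal a) F) = (∏ i, a i ^ n i) * coeff n F := by
  have hf : (fun i => ∑ j, (Matrix.diagonal a) i j • (X j : MvPolynomial (Fin 3) K))
      = fun i => C (a i) * X i := by
    funext i
    simp [Matrix.diagonal_apply, ite_smul, smul_eq_C_mul]
  unfold substPoly
  rw [hf]
  induction F using MvPolynomial.induction_on' with
  | add p q hp hq => rw [map_add, coeff_add, coeff_add, hp, hq, mul_add]
  | monomial u c =>
    rw [aeval_monomial, Finsupp.prod_fintype _ _ (by simp)]
    simp only [mul_pow, Finset.prod_mul_distrib, ← map_pow, ← map_prod]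
    rw [MvPolynomial.algebraMap_eq, ← mul_assoc, ← C_mul, coeff_C_mul, coeff_monomial]
    have : (∏ i, (X i : MvPolynomial (Fin 3) K) ^ u i) = monomial u 1 := by
      rw [monomial_eq, Finsupp.prod_fintype _ _ (by simp)]; simp
    rw [this, coeff_monomial]
    split_ifs with h
    · subst h; ring
    · simp

/-! ### Geometric consequences of nonsingularity -/

lemma eval_single_of_isHomogeneous (G : MvPolynomial (Fin 3) K) (n : ℕ)
    (h : G.IsHomogeneous n) (i : Fin 3) :
    eval (Pi.single i 1) G = coeff (Finsupp.single i n) G := by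
  rw [eval_eq']
  rw [Finset.sum_eq_single (Finsupp.single i n)]
  · have : ∏ j, (Pi.single i (1 : K) : Fin 3 → K) j ^ (Finsupp.single i n) j = 1 := by
      refine Finset.prod_eq_one fun j _ => ?_
      by_cases hj : j = i
      · subst hj; simp
      · simp [Ne.symm hj]
    rw [this, mul_one]
  · intro b hb hne
    have hdeg : b.degree = n := by
      by_contra hc
      exact (mem_support_iff.mp hb) (h.coeff_eq_zero hc)
    have : ∃ j, j ≠ i ∧ b j ≠ 0 := by
      by_contra hc
      push Not at hc
      apply hne
      have hbi : b = Finsupp.single i (b i) := by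
        ext j
        by_cases hj : j = i
        · subst hj; simp
        · simp [hc j hj, Ne.symm hj]
      rw [hbi, Finsupp.degree_single] at hdeg
      rw [hbi, hdeg]
    obtain ⟨j, hj, hbj⟩ := this
    rw [Finset.prod_eq_zero (Finset.mem_univ j), mul_zero]
    simp [hj, hbj]
  · intro hb
    simp [notMem_support_iff.mp hb]

lemma vertex_condition (F : MvPolynomial (Fin 3) K) (d : ℕ)
    (h : F.IsHomogeneous d) (hns : IsNonsingular F) (i : Fin 3) :
    ∃ j, coeff (Finsupp.single i (d - 1) + Finsupp.single j 1) F ≠ 0 := by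
  by_contra hc
  push Not at hc
  have := hns (Pi.single i 1) (by
    intro j
    rw [eval_single_of_isHomogeneous _ (d - 1) h.pderiv, coeff_pderiv, hc j]
    simp)
  have := congrFun this i
  simp at this

lemma eval_smul_of_isHomogeneous (G : MvPolynomial (Fin 3) K) (n : ℕ)
    (h : G.IsHomogeneous n) (s : K) (x : Fin 3 → K) :
    eval (s • x) G = s ^ n * eval x G := by
  rw [eval_eq', eval_eq', Finset.mul_sum]
  refine Finset.sum_congr rfl fun b hb => ?_
  have hdeg : b.degree = n := by
    by_contra hc
    exact (mem_support_iff.mp hb) (h.coeff_eq_zero hc)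
  have : ∏ i, (s • x) i ^ b i = s ^ n * ∏ i, x i ^ b i := by
    simp only [Pi.smul_apply, smul_eq_mul, mul_pow, Finset.prod_mul_distrib,
      Finset.prod_pow_eq_pow_sum]
    rw [← hdeg, Finsupp.degree_eq_sum]
  rw [this]; ring

lemma exists_restrict_line (G : MvPolynomial (Fin 3) K) (u v : Fin 3 → K) :
    ∃ p : Polynomial K, ∀ t, p.eval t = eval (u + t • v) G := by
  induction G using MvPolynomial.induction_on with
  | C a => exact ⟨Polynomial.C a, by simp⟩
  | add p q hp hq =>
    obtain ⟨pr, hp⟩ := hp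
    obtain ⟨qr, hq⟩ := hq
    exact ⟨pr + qr, by simp [hp, hq]⟩
  | mul_X p i hp =>
    obtain ⟨pr, hp⟩ := hp
    exact ⟨pr * (Polynomial.C (u i) + Polynomial.X * Polynomial.C (v i)), by intro t; simp [hp, mul_comm (v i) t]⟩

lemma exists_zero_on_line [IsAlgClosed K] (G : MvPolynomial (Fin 3) K) (n : ℕ)
    (hn : n ≠ 0) (h : G.IsHomogeneous n) (i j k : Fin 3) (hij : i ≠ j) (hik : i ≠ k)
    (hjk : j ≠ k) :
    ∃ x : Fin 3 → K, x ≠ 0 ∧ x i = 0 ∧ eval x G = 0 := by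
  by_contra hc
  push Not at hc
  obtain ⟨p, hp⟩ := exists_restrict_line G (Pi.single j 1) (Pi.single k 1)
  obtain ⟨q, hq⟩ := exists_restrict_line G (Pi.single k 1) (Pi.single j 1)
  have hpne : ∀ t, p.eval t ≠ 0 := by
    intro t
    rw [hp]
    apply hc
    · intro h0
      have := congrFun h0 j
      simp [hjk] at this
    · simp [hij, hik]
  have hdeg : p.degree = 0 := by
    by_contra hd
    obtain ⟨t, ht⟩ := IsAlgClosed.exists_root p hd
    exact hpne t ht
  obtain ⟨c, rfl⟩ : ∃ c, p = Polynomial.C c := ⟨_, Polynomial.eq_C_of_degree_eq_zero hdeg⟩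
  have hqX : q * Polynomial.X = Polynomial.C c * Polynomial.X ^ n * Polynomial.X := by
    apply Polynomial.funext
    intro s
    by_cases hs : s = 0
    · simp [hs]
    · have h1 := hp s⁻¹
      have h2 : (Pi.single k 1 + s • Pi.single j 1 : Fin 3 → K)
          = s • (Pi.single j 1 + s⁻¹ • Pi.single k 1) := by
        rw [smul_add, smul_smul, mul_inv_cancel₀ hs, one_smul, add_comm]
      simp only [Polynomial.eval_mul, Polynomial.eval_X, hq, h2, Polynomial.eval_pow,
        Polynomial.eval_C]
      rw [eval_smul_of_isHomogeneous G n h, ← h1, Polynomial.eval_C]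
      ring
  have hq2 := mul_right_cancel₀ Polynomial.X_ne_zero hqX
  have h0 := hq 0
  rw [hq2] at h0
  simp only [Polynomial.eval_mul, Polynomial.eval_X, Polynomial.eval_pow,
        Polynomial.eval_C, zero_pow hn, mul_zero, zero_smul, add_zero] at h0
  refine hc (Pi.single k 1) ?_ ?_ h0.symm
  · intro h0
    have := congrFun h0 k
    simp at this
  · simp [hik]

lemma line_condition [IsAlgClosed K] (F : MvPolynomial (Fin 3) K) (d : ℕ) (hd : 4 ≤ d)
    (h : F.IsHomogeneous d) (hns : IsNonsingular F) (i j k : Fin 3) (hij : i ≠ j) (hik : i ≠ k)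
    (hjk : j ≠ k) :
    ∃ n : Fin 3 →₀ ℕ, n i = 0 ∧ coeff n F ≠ 0 := by
  by_contra hc
  push Not at hc
  obtain ⟨x, hx0, hxi, hx⟩ := exists_zero_on_line (pderiv i F) (d - 1) (by omega) h.pderiv
    i j k hij hik hjk
  refine hx0 (hns x fun l => ?_)
  by_cases hl : l = i
  · rw [hl, hx]
  rw [eval_eq']
  refine Finset.sum_eq_zero fun b _ => ?_
  rw [coeff_pderiv]
  by_cases hb : b i = 0
  · rw [hc _ (by simp [hb, hl])]
    simp
  · rw [Finset.prod_eq_zero (Finset.mem_univ i), mul_zero]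
    simp [hxi, hb]

/-! ### Diagonalization -/

lemma exists_diagonalization [IsAlgClosed K] [CharZero K] (A : GL (Fin 3) K) (m : ℕ) (hm : m ≠ 0)
    (c : Kˣ) (hA : (A : Matrix (Fin 3) (Fin 3) K) ^ m = (c : K) • 1) :
    ∃ (P : GL (Fin 3) K) (a : Fin 3 → Kˣ),
      (A : Matrix (Fin 3) (Fin 3) K) * P = P * Matrix.diagonal (fun i => (a i : K)) := by
  set f : Module.End K (Fin 3 → K) := Matrix.toLin' (A : Matrix (Fin 3) (Fin 3) K) with hf
  have hfa : ∀ v, f v = (A : Matrix (Fin 3) (Fin 3) K) *ᵥ v := fun v => Matrix.toLin'_apply _ _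
  have hss : f.IsSemisimple := by
    apply Module.End.isSemisimple_of_squarefree_aeval_eq_zero
      (p := Polynomial.X ^ m - Polynomial.C (c : K))
    · exact (Polynomial.separable_X_pow_sub_C (c : K) (by exact_mod_cast hm) c.ne_zero).squarefree
    · rw [map_sub, map_pow, Polynomial.aeval_X, Polynomial.aeval_C, hf, ← Matrix.toLin'_pow, hA]
      ext v
      simp [Module.algebraMap_end_apply]
  have htop := hss.iSup_eigenspace_eq_top
  set s : Set (Fin 3 → K) := {v | ∃ μ : K, f v = μ • v} with hs
  have hspan : Submodule.span K s = ⊤ := by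
    rw [eq_top_iff, ← htop]
    refine iSup_le fun μ v hv => Submodule.subset_span ⟨μ, ?_⟩
    exact Module.End.mem_eigenspace_iff.mp hv
  obtain ⟨t, hts, htspan, hli⟩ := exists_linearIndependent K s
  let b0 : Module.Basis t K (Fin 3 → K) := Module.Basis.mk hli (by
    rw [Subtype.range_coe, htspan, hspan])
  have : Fintype t := FiniteDimensional.fintypeBasisIndex b0
  have hcard : Fintype.card t = 3 := by
    rw [← Module.finrank_eq_card_basis b0]; simp
  let b : Module.Basis (Fin 3) K (Fin 3 → K) := b0.reindex (Fintype.equivFinOfCardEq hcard)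
  have hb : ∀ i, ∃ μ : K, f (b i) = μ • b i := by
    intro i
    have : b i ∈ s := by
      simp only [b, b0, Module.Basis.reindex_apply, Module.Basis.mk_apply]
      exact hts (Subtype.coe_prop _)
    exact this
  choose μ hμ using hb
  have hμ0 : ∀ i, μ i ≠ 0 := by
    intro i h0
    have h1 := hμ i
    rw [h0, zero_smul, hfa] at h1
    have h3 : (((A⁻¹ : GL (Fin 3) K) : Matrix (Fin 3) (Fin 3) K) *
        (A : Matrix (Fin 3) (Fin 3) K)) *ᵥ (b i) = 0 := by
      rw [← Matrix.mulVec_mulVec, h1, Matrix.mulVec_zero]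
    rw [← Units.val_mul, inv_mul_cancel, Units.val_one, Matrix.one_mulVec] at h3
    exact b.ne_zero i h3
  let e := Pi.basisFun K (Fin 3)
  let P : GL (Fin 3) K := ⟨e.toMatrix b, b.toMatrix e, e.toMatrix_mul_toMatrix_flip b,
    b.toMatrix_mul_toMatrix_flip e⟩
  refine ⟨P, fun i => Units.mk0 (μ i) (hμ0 i), ?_⟩
  ext i j
  have hP : ∀ i j, (P : Matrix (Fin 3) (Fin 3) K) i j = b j i := fun i j => by
    simp [P, e, Module.Basis.toMatrix_apply]
  rw [Matrix.mul_diagonal]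
  have := congrFun (hμ j) i
  rw [hfa] at this
  simp only [Matrix.mul_apply, hP, Units.val_mk0]
  simpa [Matrix.mulVec, dotProduct, mul_comm (μ j)] using this

/-! ### The group-theoretic case analysis -/

lemma types_of_map (f : Fin 3 → Fin 3) : ∃ i j k : Fin 3, (i ≠ j ∧ i ≠ k ∧ j ≠ k) ∧
    (∀ l, l = i ∨ l = j ∨ l = k) ∧
    ((f i = i ∧ f j = j ∧ f k = k) ∨ (f i = i ∧ f j = j ∧ f k = j) ∨
     (f i = i ∧ f j = i ∧ f k = i) ∨ (f i = i ∧ f j = k ∧ f k = i) ∨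
     (f i = i ∧ f j = k ∧ f k = j) ∨ (f i = j ∧ f j = k ∧ f k = i) ∨
     (f i = j ∧ f j = i ∧ f k = i)) := by
  revert f
  decide

lemma exponent_cases {M : Type*} [AddCommGroup M] (d : ℤ) (x : Fin 3 → M) (l : M)
    (hv : ∀ i, ∃ j, (d - 1) • x i + x j = l)
    (hline : ∀ i j k : Fin 3, (i ≠ j ∧ i ≠ k ∧ j ≠ k) →
      ∃ p q : ℤ, p + q = d ∧ p • x j + q • x k = l) :
    ∃ N : ℤ, (N = d - 1 ∨ N = d ∨ N = d * d - 3 * d + 3 ∨ N = (d - 1) ^ 2 ∨ N = d * (d - 2) ∨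
      N = d * (d - 1)) ∧ ∃ y, ∀ i, N • x i = y := by
  choose f hf using hv
  obtain ⟨i, j, k, hne, hall, hcase⟩ := types_of_map f
  have hi := hf i
  have hj := hf j
  have hk := hf k
  have fin : ∀ N : ℤ, N • x j = N • x i → N • x k = N • x i → ∃ y, ∀ i, N • x i = y := by
    intro N h1 h2
    refine ⟨N • x i, fun t => ?_⟩
    rcases hall t with rfl | rfl | rfl
    · rfl
    · exact h1
    · exact h2
  rcases hcase with ⟨h1, h2, h3⟩ | ⟨h1, h2, h3⟩ | ⟨h1, h2, h3⟩ | ⟨h1, h2, h3⟩ | ⟨h1, h2, h3⟩ |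
    ⟨h1, h2, h3⟩ | ⟨h1, h2, h3⟩ <;> rw [h1] at hi <;> rw [h2] at hj <;> rw [h3] at hk
  · refine ⟨d, by tauto, fin _ ?_ ?_⟩
    · linear_combination (norm := module) hj - hi
    · linear_combination (norm := module) hk - hi
  · refine ⟨d * (d - 1), by tauto, fin _ ?_ ?_⟩
    · linear_combination (norm := module) (d - 1) • hj - (d - 1) • hi
    · linear_combination (norm := module) d • hk - d • hj + (d - 1) • hj - (d - 1) • hi
  · refine ⟨d - 1, by tauto, fin _ ?_ ?_⟩
    · linear_combination (norm := module) hj - hi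
    · linear_combination (norm := module) hk - hi
  · refine ⟨(d - 1) ^ 2, by tauto, fin _ ?_ ?_⟩
    · linear_combination (norm := module) (d - 1) • hj - (d - 1) • hi - hk + hi
    · linear_combination (norm := module) (d - 1) • hk - (d - 1) • hi
  · refine ⟨d * (d - 2), by tauto, fin _ ?_ ?_⟩
    · linear_combination (norm := module) (d - 1) • hj - (d - 1) • hi - hk + hi
    · linear_combination (norm := module) (d - 1) • hk - (d - 1) • hi - hj + hi
  · have e1 : (d * d - 3 * d + 3) • x j = (d * d - 3 * d + 3) • x i := by
      linear_combination (norm := module) (-(d - 2)) • hi + (d - 2) • hj + hj - hk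
    have e2 : (d * d - 3 * d + 3) • x k = (d * d - 3 * d + 3) • x j := by
      linear_combination (norm := module) hj - hi - (d - 1) • hj + (d - 1) • hk
    exact ⟨d * d - 3 * d + 3, by tauto, fin _ e1 (e2.trans e1)⟩
  · obtain ⟨p, q, hpq, hl⟩ := hline i j k hne
    obtain rfl : q = d - p := by linarith
    have hu : (d - 2) • (x j - x i) = 0 := by
      linear_combination (norm := module) hj - hi
    have hw : (d - 1) • (x k - x i) = x j - x i := by
      linear_combination (norm := module) hk - hi
    have hw2 : (p * (d - 2) + 1) • (x k - x i) = 0 := by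
      linear_combination (norm := module) hl - hk + p • hw
    have hu0 : x j - x i = 0 := by
      linear_combination (norm := module) (d - 1) • hw2 - p • hu - (p * (d - 2) + 1) • hw
    refine ⟨d - 1, by tauto, fin _ ?_ ?_⟩
    · linear_combination (norm := module) (d - 1) • hu0
    · linear_combination (norm := module) hw + hu0

/-! ### Assembling -/

/-- The diagonal matrix with the given unit entries, as a group homomorphism. -/
def diagGL : (Fin 3 → Kˣ) →* GL (Fin 3) K where
  toFun a := ⟨Matrix.diagonal fun i => (a i : K), Matrix.diagonal fun i => ((a i)⁻¹ : Kˣ),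
    by simp, by simp⟩
  map_one' := by ext; simp
  map_mul' a b := by
    apply Units.ext
    simp [Matrix.diagonal_mul_diagonal]

lemma diagGL_const_mem_center (u : Kˣ) :
    diagGL (fun _ => u) ∈ Subgroup.center (GL (Fin 3) K) := by
  rw [Subgroup.mem_center_iff]
  intro B
  apply Units.ext
  ext i j
  simp [diagGL, mul_comm]

lemma zpow_mem_center (A P : GL (Fin 3) K) (a : Fin 3 → Kˣ) (hA : A * P = P * diagGL a) (N : ℤ)
    (u : Kˣ) (hN : ∀ i, a i ^ N = u) : A ^ N ∈ Subgroup.center (GL (Fin 3) K) := by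
  have h1 : A = P * diagGL a * P⁻¹ := by rw [← hA]; group
  rw [h1, conj_zpow, ← map_zpow, show a ^ N = fun _ => u from funext hN]
  exact (inferInstance : (Subgroup.center (GL (Fin 3) K)).Normal).conj_mem _
    (diagGL_const_mem_center u) P

lemma monomial_condition (a : Fin 3 → Kˣ) (c : Kˣ) (F : MvPolynomial (Fin 3) K)
    (h : substPoly (Matrix.diagonal fun i => (a i : K)) F = (c : K) • F) (n : Fin 3 →₀ ℕ)
    (hn : coeff n F ≠ 0) : ∏ i, a i ^ n i = c := by
  have h1 := congrArg (coeff n) h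
  rw [coeff_substPoly_diagonal, coeff_smul, smul_eq_mul] at h1
  have := mul_right_cancel₀ hn h1
  apply Units.ext
  rw [← this]
  simp

/-- the order of any automorphism of a nonsingular plane curve of degree
`d ≥ 4` divides one of `d-1, d, d²-3d+3, (d-1)², d(d-2), d(d-1)`; in particular it is
at most `d(d-1)`. -/
theorem stmt0 {K : Type*} [Field K] [IsAlgClosed K] [CharZero K]
    (d : ℕ) (hd : 4 ≤ d) (F : MvPolynomial (Fin 3) K)
    (hhom : F.IsHomogeneous d) (hns : IsNonsingular F)
    (m : ℕ) (hm : 1 ≤ m) (g : PGL3 K) (hg : g ∈ projAut F) (hord : orderOf g = m) :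
    (m ∣ d - 1 ∨ m ∣ d ∨ m ∣ d * d - 3 * d + 3 ∨ m ∣ (d - 1) ^ 2 ∨
      m ∣ d * (d - 2) ∨ m ∣ d * (d - 1)) ∧ m ≤ d * (d - 1) := by
  obtain ⟨A, ⟨c, hc⟩, rfl⟩ := hg
  have hgm : QuotientGroup.mk' (Subgroup.center (GL (Fin 3) K)) A ^ m = 1 := by
    rw [← hord]; exact pow_orderOf_eq_one _
  have hAm : A ^ m ∈ Subgroup.center (GL (Fin 3) K) := by
    rw [← map_pow] at hgm
    exact (QuotientGroup.eq_one_iff _).mp hgm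
  rw [Matrix.GeneralLinearGroup.center_eq_range_scalar] at hAm
  obtain ⟨r, hr⟩ := hAm
  have hAmr : (A : Matrix (Fin 3) (Fin 3) K) ^ m = (r : K) • 1 := by
    rw [← Units.val_pow_eq_pow_val, ← hr]
    ext i j
    simp [Matrix.smul_apply, Matrix.one_apply, Matrix.diagonal_apply]
  obtain ⟨P, a, hP⟩ := exists_diagonalization A m (by omega) r hAmr
  set FP := substPoly (P : Matrix (Fin 3) (Fin 3) K) F with hFP
  have hnsP : IsNonsingular FP := isNonsingular_substPoly P F hns
  have hhomP : FP.IsHomogeneous d := isHomogeneous_substPoly _ F d hhom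
  have hdiag : substPoly (Matrix.diagonal fun i => (a i : K)) FP = (c : K) • FP := by
    rw [hFP, ← substPoly_mul, ← hP, substPoly_mul, hc, substPoly_smul]
  have hmon := monomial_condition a c FP hdiag
  have hdc : ((d - 1 : ℕ) : ℤ) = (d : ℤ) - 1 := by push_cast [show 1 ≤ d by omega]; rfl
  obtain ⟨N, hN, y, hy⟩ := exponent_cases (d : ℤ) (fun i => Additive.ofMul (a i))
    (Additive.ofMul c) (by
      intro i
      obtain ⟨j, hj⟩ := vertex_condition FP d hhomP hnsP i
      refine ⟨j, ?_⟩
      have h1 := hmon _ hj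
      rw [← hdc, natCast_zsmul, ← ofMul_pow, ← ofMul_mul]
      congr 1
      rw [← h1]
      simp only [Finsupp.add_apply, pow_add, Finset.prod_mul_distrib]
      congr 1
      · rw [Finset.prod_eq_single i] <;> simp +contextual [eq_comm]
      · rw [Finset.prod_eq_single j] <;> simp +contextual [eq_comm]) (by
      rintro i j k ⟨hij, hik, hjk⟩
      obtain ⟨n, hni, hn⟩ := line_condition FP d hd hhomP hnsP i j k hij hik hjk
      have hdeg : n.degree = d := by
        by_contra hne
        exact hn (hhomP.coeff_eq_zero hne)
      have huniv : (Finset.univ : Finset (Fin 3)) = {i, j, k} := by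
        clear hn hni hdeg; revert i j k; decide
      refine ⟨n j, n k, ?_, ?_⟩
      · rw [Finsupp.degree_eq_sum, huniv, Finset.sum_insert (by simp [hij, hik]),
          Finset.sum_pair hjk, hni] at hdeg
        exact_mod_cast (by omega : n j + n k = d)
      · have h1 := hmon _ hn
        rw [huniv, Finset.prod_insert (by simp [hij, hik]), Finset.prod_pair hjk, hni, pow_zero,
          one_mul] at h1
        rw [natCast_zsmul, natCast_zsmul, ← ofMul_pow, ← ofMul_pow, ← ofMul_mul, h1])
  have hAN : A ^ N ∈ Subgroup.center (GL (Fin 3) K) :=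
    zpow_mem_center A P a (Units.ext hP) N y.toMul fun i => congrArg Additive.toMul (hy i)
  have hdvd : (m : ℤ) ∣ N := by
    rw [← hord, orderOf_dvd_iff_zpow_eq_one, ← map_zpow]
    exact (QuotientGroup.eq_one_iff _).mpr hAN
  obtain ⟨e, rfl⟩ : ∃ e, d = e + 4 := ⟨d - 4, by omega⟩
  have h3 : (e + 4) * (e + 4) - 3 * (e + 4) + 3 = e * e + 5 * e + 7 := by
    have : (e + 4) * (e + 4) = e * e + 5 * e + 4 + 3 * (e + 4) := by ring
    rw [this, Nat.add_sub_cancel]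
  have h1 : e + 4 - 1 = e + 3 := by omega
  have h2 : e + 4 - 2 = e + 2 := by omega
  rw [h1, h2, h3]
  have key : m ∣ e + 3 ∨ m ∣ e + 4 ∨ m ∣ e * e + 5 * e + 7 ∨ m ∣ (e + 3) ^ 2 ∨
      m ∣ (e + 4) * (e + 2) ∨ m ∣ (e + 4) * (e + 3) := by
    rcases hN with h | h | h | h | h | h
    · left
      zify
      convert hdvd using 1
      rw [h]; push_cast; ring
    · right; left
      zify
      convert hdvd using 1
      rw [h]; push_cast; ring
    · right; right; left
      zify
      convert hdvd using 1
      rw [h]; push_cast; ring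
    · right; right; right; left
      zify
      convert hdvd using 1
      rw [h]; push_cast; ring
    · right; right; right; right; left
      zify
      convert hdvd using 1
      rw [h]; push_cast; ring
    · right; right; right; right; right
      zify
      convert hdvd using 1
      rw [h]; push_cast; ring
  refine ⟨key, ?_⟩
  rcases key with h | h | h | h | h | h <;>
    exact (Nat.le_of_dvd (by positivity) h).trans (by nlinarith)

end
end

section
/- Let K be an algebraically closed field of characteristic 0 and let d ≥ 5. For any α ∈ K^×, the automorphism group of the nonsingular plane curve defined by F = X^d + Y^{d−1}·Z + α·X·Z^{d−1} is cyclic of order (d−1)². -/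
open MvPolynomial Matrix

noncomputable section

variable {K : Type*} [Field K]

lemma two_deriv_zero {K : Type*} [Field K] (l p m q e : K) (hl : l ≠ 0) (k : ℕ) (a b c : K)
    (h : ∀ t : K, e * (l * t + p) ^ (k + 3) * (m * t + q) = a * t ^ (k + 4) + b + c * t)
    [CharZero K] (ha : a ≠ 0) : p = 0 := by
  have hp : (Polynomial.C e * (Polynomial.C l * Polynomial.X + Polynomial.C p) ^ (k + 3) *
      (Polynomial.C m * Polynomial.X + Polynomial.C q) : Polynomial K)
      = Polynomial.C a * Polynomial.X ^ (k + 4) + Polynomial.C b + Polynomial.C c * Polynomial.X := by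
    apply Polynomial.funext
    intro t
    simpa using h t
  have h2 := congrArg (fun P => (Polynomial.derivative (Polynomial.derivative P)).eval (-p / l)) hp
  have h0 : l * (-p / l) + p = 0 := by field_simp; ring
  simp [Polynomial.derivative_mul, Polynomial.derivative_pow, h0] at h2
  have h3 : ((k : K) + 4) ≠ 0 := by exact_mod_cast (by omega : k + 4 ≠ 0)
  have h4 : ((k : K) + 3) ≠ 0 := by exact_mod_cast (by omega : k + 3 ≠ 0)
  grind

lemma one_deriv_zero {K : Type*} [Field K] (l p m q e : K) (hl : l ≠ 0) (k : ℕ) (c : K)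
    (h : ∀ t : K, e * (l * t + p) ^ (k + 3) * (m * t + q) = c * t)
    [CharZero K] : c = 0 := by
  have hp : (Polynomial.C e * (Polynomial.C l * Polynomial.X + Polynomial.C p) ^ (k + 3) *
      (Polynomial.C m * Polynomial.X + Polynomial.C q) : Polynomial K)
      = Polynomial.C c * Polynomial.X := by
    apply Polynomial.funext
    intro t
    simpa using h t
  have h2 := congrArg (fun P => (Polynomial.derivative P).eval (-p / l)) hp
  have h0 : l * (-p / l) + p = 0 := by field_simp; ring
  simp [Polynomial.derivative_mul, Polynomial.derivative_pow, h0] at h2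
  exact h2.symm

lemma last_deriv {K : Type*} [Field K] [CharZero K] (r s b c α : K) (hr : r ≠ 0) (k : ℕ)
    (h : ∀ t : K, (r * t + s) ^ (k + 5) + b * (r * t + s) = c * (t ^ (k + 5) + α * t)) :
    s = 0 := by
  have hp : ((Polynomial.C r * Polynomial.X + Polynomial.C s) ^ (k + 5) +
      Polynomial.C b * (Polynomial.C r * Polynomial.X + Polynomial.C s) : Polynomial K)
      = Polynomial.C c * (Polynomial.X ^ (k + 5) + Polynomial.C α * Polynomial.X) := by
    apply Polynomial.funext
    intro t
    simpa using h t
  have h2 := congrArg (fun P => (Polynomial.derivative (Polynomial.derivative P)).eval 0) hp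
  simp [Polynomial.derivative_mul, Polynomial.derivative_pow] at h2
  have h3 : ((k : K) + 4) ≠ 0 := by exact_mod_cast (by omega : k + 4 ≠ 0)
  have h4 : ((k : K) + 5) ≠ 0 := by exact_mod_cast (by omega : k + 5 ≠ 0)
  grind

/-- derivative identity -/
lemma deriv_ident {K : Type*} [Field K] [CharZero K] (k : ℕ) (α e : K) (p q r a b c x y z : K)
    (h : ∀ t : K, p ^ (k + 5) + (q + t) ^ (k + 4) * r + α * p * r ^ (k + 4)
      = e * ((x + a * t) ^ (k + 5) + (y + b * t) ^ (k + 4) * (z + c * t)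
        + α * (x + a * t) * (z + c * t) ^ (k + 4))) :
    ((k : K) + 4) * q ^ (k + 3) * r = e * (a * (((k : K) + 5) * x ^ (k + 4) + α * z ^ (k + 4))
      + ((k : K) + 4) * b * y ^ (k + 3) * z
      + c * (y ^ (k + 4) + ((k : K) + 4) * α * x * z ^ (k + 3))) := by
  have hp : (Polynomial.C (p ^ (k + 5)) + (Polynomial.C q + Polynomial.X) ^ (k + 4) * Polynomial.C r
      + Polynomial.C (α * p * r ^ (k + 4)) : Polynomial K)
      = Polynomial.C e * ((Polynomial.C x + Polynomial.C a * Polynomial.X) ^ (k + 5)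
      + (Polynomial.C y + Polynomial.C b * Polynomial.X) ^ (k + 4)
        * (Polynomial.C z + Polynomial.C c * Polynomial.X)
      + Polynomial.C α * (Polynomial.C x + Polynomial.C a * Polynomial.X)
        * (Polynomial.C z + Polynomial.C c * Polynomial.X) ^ (k + 4)) := by
    apply Polynomial.funext
    intro t
    simpa using h t
  have h2 := congrArg (fun P => (Polynomial.derivative P).eval 0) hp
  simp [Polynomial.derivative_mul, Polynomial.derivative_pow] at h2
  linear_combination h2

lemma core {K : Type*} [Field K] [CharZero K] (k : ℕ) (α : K) (hα : α ≠ 0)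
    (l0 l1 l2 m0 m1 m2 a b c : K) (habc : a ≠ 0 ∨ b ≠ 0 ∨ c ≠ 0)
    (h : ∀ x y z : K, ((k : K) + 4) * (l0 * x + l1 * y + l2 * z) ^ (k + 3)
        * (m0 * x + m1 * y + m2 * z) =
      (a * (((k : K) + 5) * x ^ (k + 4) + α * z ^ (k + 4))
      + ((k : K) + 4) * b * y ^ (k + 3) * z
      + c * (y ^ (k + 4) + ((k : K) + 4) * α * x * z ^ (k + 3)))) :
    l0 = 0 ∧ l2 = 0 ∧ m0 = 0 ∧ m1 = 0 := by
  have h3 : ((k : K) + 4) ≠ 0 := by exact_mod_cast (by omega : k + 4 ≠ 0)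
  have h4 : ((k : K) + 5) ≠ 0 := by exact_mod_cast (by omega : k + 5 ≠ 0)
  have ha : a = 0 := by
    by_contra ha
    have e1 := h 1 0 0
    have hl0 : l0 ≠ 0 := by
      rintro rfl
      simp at e1
      tauto
    have hl : ∀ y z : K, l1 * y + l2 * z = 0 := fun y z =>
      two_deriv_zero l0 (l1 * y + l2 * z) m0 (m1 * y + m2 * z) ((k : K) + 4) hl0 k
        (a * ((k : K) + 5)) (a * α * z ^ (k + 4) + ((k : K) + 4) * b * y ^ (k + 3) * z
          + c * y ^ (k + 4)) (c * (((k : K) + 4) * α * z ^ (k + 3)))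
        (fun t => by rw [← add_assoc, ← add_assoc, h t y z]; ring) (mul_ne_zero ha h4)
    have hl2 : l2 = 0 := by simpa using hl 0 1
    have e2 := h 0 0 1
    simp [hl2] at e2
    tauto
  subst ha
  have hc : c = 0 := by
    by_contra hc
    have hl0 : l0 = 0 := by
      by_contra hl0
      have := one_deriv_zero l0 l2 m0 m2 ((k : K) + 4) hl0 k (c * (((k : K) + 4) * α))
        (fun t => by have := h t 0 1; simp at this; grind)
      simp at this
      tauto
    subst hl0
    have hl1 : l1 ≠ 0 := by
      rintro rfl
      have e1 := h 0 1 0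
      simp at e1
      exact hc e1.symm
    have e0 := h 0 (-l2 / l1) 1
    have e1 := h 1 (-l2 / l1) 1
    have hz : l1 * (-l2 / l1) + l2 = 0 := by field_simp; ring
    simp [hz] at e0 e1
    have : c * (((k : K) + 4) * α) = 0 := by linear_combination e0 - e1
    simp at this
    tauto
  subst hc
  have hb : b ≠ 0 := by tauto
  have hl0 : l0 = 0 := by
    by_contra hl0
    obtain ⟨t, hz⟩ : ∃ t, l0 * t + l1 + l2 = 0 :=
      ⟨-(l1 + l2) / l0, by field_simp; ring⟩
    have e := h t 1 1
    simp [hz] at e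
    tauto
  have hm0 : m0 = 0 := by
    by_contra hm0
    obtain ⟨t, hz⟩ : ∃ t, m0 * t + m1 + m2 = 0 :=
      ⟨-(m1 + m2) / m0, by field_simp; ring⟩
    have e := h t 1 1
    simp [hz] at e
    tauto
  subst hl0 hm0
  have hl2 : l2 = 0 := by
    by_contra hl2
    have e := h 0 l2 (-l1)
    have hz : l1 * l2 + -(l2 * l1) = 0 := by ring
    simp [hz] at e
    have hl1 : l1 = 0 := by tauto
    subst hl1
    have e1 := h 0 0 1
    simp at e1
    have hm2 : m2 = 0 := by tauto
    subst hm2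
    have e2 := h 0 1 1
    have e3 := h 0 1 2
    simp [mul_pow] at e2 e3
    have : (2 : K) ^ (k + 2) - 1 = 0 := by
      have : (((k : K) + 4) * b) * 2 * ((2 : K) ^ (k + 2) - 1) = 0 := by
        linear_combination e3 - 2 ^ (k + 3) * e2
      simpa [hb, h3] using this
    have h5 : (2 : ℕ) ^ (k + 2) = 1 := by
      have := sub_eq_zero.mp this
      exact_mod_cast this
    simp at h5
  subst hl2
  refine ⟨rfl, rfl, rfl, ?_⟩
  have e1 := h 0 1 0
  have e2 := h 0 1 1
  simp at e1 e2
  have hl1 : l1 ≠ 0 := by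
    rintro rfl
    simp at e2
    tauto
  tauto

/-- the curve's polynomial -/
def curveF {K : Type*} [Field K] (k : ℕ) (α : K) : MvPolynomial (Fin 3) K :=
  X 0 ^ (k + 5) + X 1 ^ (k + 4) * X 2 + C α * X 0 * X 2 ^ (k + 4)

lemma eval_subst {K : Type*} [Field K] (k : ℕ) (α : K) (B : Matrix (Fin 3) (Fin 3) K)
    (x : Fin 3 → K) : eval x (substPoly B (curveF k α)) =
      (B *ᵥ x) 0 ^ (k + 5) + (B *ᵥ x) 1 ^ (k + 4) * (B *ᵥ x) 2
        + α * (B *ᵥ x) 0 * (B *ᵥ x) 2 ^ (k + 4) := by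
  simp [substPoly, curveF, Matrix.mulVec, dotProduct, smul_eval]

lemma eval_curve {K : Type*} [Field K] (k : ℕ) (α : K)
    (x : Fin 3 → K) : eval x (curveF k α) =
      x 0 ^ (k + 5) + x 1 ^ (k + 4) * x 2 + α * x 0 * x 2 ^ (k + 4) := by
  simp [curveF]

lemma aut_diag {K : Type*} [Field K] [CharZero K] (k : ℕ) (α : K) (hα : α ≠ 0)
    (B : GL (Fin 3) K) (hB : B ∈ autGL (curveF k α)) :
    ∃ r l m : Kˣ, (B : Matrix (Fin 3) (Fin 3) K) = Matrix.diagonal ![(r : K), l, m] ∧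
      r ^ (k + 5) = l ^ (k + 4) * m ∧ r ^ (k + 5) = r * m ^ (k + 4) := by
  obtain ⟨c, hc⟩ := hB
  have hx : ∀ x : Fin 3 → K, _ := fun x => congrArg (eval x) hc
  simp only [eval_subst, smul_eval, eval_curve] at hx
  set M : Matrix (Fin 3) (Fin 3) K := (B : Matrix (Fin 3) (Fin 3) K) with hM
  set v : Fin 3 → K := ((B⁻¹ : GL (Fin 3) K) : Matrix (Fin 3) (Fin 3) K) *ᵥ ![0, 1, 0] with hv
  have hMv : M *ᵥ v = ![0, 1, 0] := by
    rw [hv, hM, Matrix.mulVec_mulVec, ← Units.val_mul, mul_inv_cancel, Units.val_one,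
      Matrix.one_mulVec]
  have hv0 : v ≠ 0 := by
    intro h
    rw [h, Matrix.mulVec_zero] at hMv
    simpa using congrFun hMv 1
  have hrow : ∀ (i : Fin 3) (x : Fin 3 → K), (M *ᵥ x) i = M i 0 * x 0 + M i 1 * x 1 + M i 2 * x 2 := by
    intro i x
    simp [Matrix.mulVec, dotProduct, Fin.sum_univ_three]
  have hcore := core k α hα (M 1 0) (M 1 1) (M 1 2) (M 2 0) (M 2 1) (M 2 2)
    (c * v 0) (c * v 1) (c * v 2) (by
      by_contra hcon
      push Not at hcon
      simp at hcon
      apply hv0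
      ext i
      fin_cases i <;> simp [hcon]) (by
      intro x y z
      have := deriv_ident k α c ((M *ᵥ ![x, y, z]) 0) ((M *ᵥ ![x, y, z]) 1) ((M *ᵥ ![x, y, z]) 2)
        (v 0) (v 1) (v 2) x y z (by
          intro t
          have h := hx (![x, y, z] + t • v)
          rw [Matrix.mulVec_add, Matrix.mulVec_smul, hMv] at h
          simp only [Pi.add_apply, Pi.smul_apply, smul_eq_mul] at h
          simp at h
          rw [h]
          ring)
      simp only [hrow] at this
      simp at this
      rw [this]
      ring)
  obtain ⟨h10, h12, h20, h21⟩ := hcore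
  have hval : ∀ x y z : K, (M 0 0 * x + M 0 1 * y + M 0 2 * z) ^ (k + 5)
      + (M 1 1 * y) ^ (k + 4) * (M 2 2 * z)
      + α * (M 0 0 * x + M 0 1 * y + M 0 2 * z) * (M 2 2 * z) ^ (k + 4)
      = c * (x ^ (k + 5) + y ^ (k + 4) * z + α * x * z ^ (k + 4)) := by
    intro x y z
    have := hx ![x, y, z]
    simp only [hrow] at this
    simpa [h10, h12, h20, h21] using this
  have e1 := hval 0 1 0
  simp at e1
  have e2 := hval 1 0 0
  simp at e2
  have h00 : M 0 0 ≠ 0 := by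
    intro h
    simp [h] at e2
    exact c.ne_zero e2.symm
  have h02 : M 0 2 = 0 := by
    apply last_deriv (M 0 0) (M 0 2) (α * M 2 2 ^ (k + 4)) c α h00 k
    intro t
    have := hval t 0 1
    simp at this
    rw [← this]
    ring
  have e3 := hval 0 1 1
  simp [e1, h02] at e3
  have e4 := hval 1 0 1
  simp [h02, e2] at e4
  have e5 : M 0 0 * M 2 2 ^ (k + 4) = c := by
    apply mul_left_cancel₀ hα
    linear_combination e4
  have h11 : M 1 1 ≠ 0 := by
    intro h
    simp [h] at e3
    exact c.ne_zero e3.symm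
  have h22 : M 2 2 ≠ 0 := by
    intro h
    simp [h] at e3
    exact c.ne_zero e3.symm
  refine ⟨Units.mk0 _ h00, Units.mk0 _ h11, Units.mk0 _ h22, ?_, ?_, ?_⟩
  · ext i j
    fin_cases i <;> fin_cases j <;> simp [h10, h12, h20, h21, e1, h02]
  · ext
    simp [e2, e3, e5]
  · ext
    simp [e2, e3, e5]

/-- diagonal torus embedded in `GL₃`. -/
def diagHom (K : Type*) [Field K] : (Fin 3 → Kˣ) →* GL (Fin 3) K :=
  (Units.map (Matrix.diagonalRingHom (Fin 3) K).toMonoidHom).comp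
    (MulEquiv.piUnits (M := fun _ : Fin 3 => K)).symm.toMonoidHom

lemma diagHom_val {K : Type*} [Field K] (f : Fin 3 → Kˣ) :
    (diagHom K f : Matrix (Fin 3) (Fin 3) K) = Matrix.diagonal (fun i => (f i : K)) := rfl

/-- one-parameter subgroup -/
def oneParam (K : Type*) [Field K] (n : ℕ) : Kˣ →* (Fin 3 → Kˣ) where
  toFun s := ![1, s, (s ^ n)⁻¹]
  map_one' := by ext i; fin_cases i <;> simp
  map_mul' a b := by
    ext i
    fin_cases i <;> simp [mul_pow, mul_comm]

/-- roots of unity into `PGL₃`. -/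
def rootsHom (K : Type*) [Field K] (n : ℕ) : rootsOfUnity (n ^ 2) K →* PGL3 K :=
  (QuotientGroup.mk' (Subgroup.center (GL (Fin 3) K))).comp
    ((diagHom K).comp ((oneParam K n).comp (rootsOfUnity (n ^ 2) K).subtype))

lemma rootsHom_injective (K : Type*) [Field K] (n : ℕ) : Function.Injective (rootsHom K n) := by
  rw [injective_iff_map_eq_one]
  intro s hs
  have hs' : diagHom K (oneParam K n (s : Kˣ)) ∈ Subgroup.center (GL (Fin 3) K) :=
    (QuotientGroup.eq_one_iff _).mp hs
  rw [Matrix.GeneralLinearGroup.mem_center_iff_val_mem_range_scalar] at hs'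
  obtain ⟨a, ha⟩ := hs'
  rw [diagHom_val] at ha
  have h0 := congrFun (congrFun ha 0) 0
  have h1 := congrFun (congrFun ha 1) 1
  simp [oneParam] at h0 h1
  ext
  simp [← h1, h0]

lemma rootsHom_range {K : Type*} [Field K] [CharZero K] (k : ℕ) (α : K) (hα : α ≠ 0) :
    (rootsHom K (k + 4)).range = projAut (curveF k α) := by
  apply le_antisymm
  · rintro _ ⟨s, rfl⟩
    refine ⟨diagHom K (oneParam K (k + 4) (s : Kˣ)), ⟨1, ?_⟩, rfl⟩
    have hs : ((s : Kˣ) : K) ^ ((k + 4) ^ 2) = 1 := by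
      have := (mem_rootsOfUnity _ _).mp s.2
      simpa using congrArg Units.val this
    have hs0 : ((s : Kˣ) : K) ≠ 0 := Units.ne_zero _
    rw [diagHom_val]
    apply MvPolynomial.funext
    intro x
    rw [eval_subst, smul_eval, eval_curve]
    simp only [Matrix.mulVec_diagonal]
    simp [oneParam, mul_pow]
    rw [← pow_mul, ← sq, hs]
    field_simp
  · rintro _ ⟨A, hA, rfl⟩
    obtain ⟨r, l, m, hM, h1, h2⟩ := aut_diag k α hα A hA
    have hA' : A = diagHom K (fun _ => r) * diagHom K ![1, l / r, m / r] := by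
      rw [← map_mul]
      ext i j
      rw [hM, diagHom_val]
      fin_cases i <;> fin_cases j <;> simp <;> field_simp
    have h3 : m ^ (k + 4) = r ^ (k + 4) := by
      rw [pow_succ', mul_right_inj] at h2
      exact h2.symm
    have h4 : m / r = ((l / r) ^ (k + 4))⁻¹ := by
      rw [eq_inv_iff_mul_eq_one, div_pow, div_mul_div_comm, mul_comm m, ← h1, ← pow_succ',
        div_self']
    refine ⟨⟨l / r, ?_⟩, ?_⟩
    · rw [mem_rootsOfUnity, sq, pow_mul, ← _root_.inv_inj, ← inv_pow, ← h4, div_pow, h3]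
      simp
    · rw [hA', map_mul]
      have : (QuotientGroup.mk' (Subgroup.center (GL (Fin 3) K))) (diagHom K (fun _ => r)) = 1 := by
        refine (QuotientGroup.eq_one_iff _).mpr ?_
        rw [Matrix.GeneralLinearGroup.mem_center_iff_val_mem_range_scalar]
        exact ⟨r, rfl⟩
      have hv : oneParam K (k + 4) (l / r) = ![1, l / r, m / r] := by
        rw [h4]
        rfl
      rw [this, one_mul, ← hv]
      rfl

/-- for `d ≥ 5` and `α ≠ 0`, the automorphism group of the nonsingular
plane curve `X^d + Y^(d-1)·Z + α·X·Z^(d-1)` is cyclic of order `(d-1)²`. -/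
theorem stmt2 {K : Type*} [Field K] [IsAlgClosed K] [CharZero K]
    (d : ℕ) (hd : 5 ≤ d) (α : K) (hα : α ≠ 0)
    (F : MvPolynomial (Fin 3) K)
    (hF : F = X 0 ^ d + X 1 ^ (d - 1) * X 2 + C α * X 0 * X 2 ^ (d - 1)) :
    IsCyclic ↥(projAut F) ∧ Nat.card ↥(projAut F) = (d - 1) ^ 2 := by
  obtain ⟨k, rfl⟩ := Nat.exists_eq_add_of_le' hd
  have hF' : F = curveF k α := hF
  have hr := rootsHom_range k α hα
  rw [← hF'] at hr
  rw [← hr]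
  change _ ∧ _ = (k + 4) ^ 2
  have e := MonoidHom.ofInjective (rootsHom_injective K (k + 4))
  have : NeZero ((k + 4) ^ 2) := ⟨by positivity⟩
  have : NeZero (((k + 4) ^ 2 : ℕ) : K) := ⟨by exact_mod_cast (by positivity : (k + 4) ^ 2 ≠ 0)⟩
  refine ⟨e.isCyclic.mp inferInstance, ?_⟩
  rw [← Nat.card_congr e.toEquiv]
  exact HasEnoughRootsOfUnity.natCard_rootsOfUnity K ((k + 4) ^ 2)

end
end
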